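/- Let f : ℝ² → ℂ be a smooth compactly supported function and let y_1, y_2 ∈ ℝ. Then lim_{λ→+∞} lim_{ε→0+} ∫_{ℝ²} f(x_1, x_2) e^{iλ(x_1 + x_2 − y_1 − y_2)} (x_1 − x_2)(y_2 − y_1) / [(x_1 − y_1 − iε)(x_1 − y_2 − iε)(x_2 − y_1 − iε)(x_2 − y_2 − iε)] dx_1 dx_2 = (2πi)² ( f(y_1, y_2) − f(y_2, y_1) ). -/

import Mathlib

open Filter MeasureTheory Complex

open FourierTransform in
lemma aux_fourier (f : ℝ × ℝ → ℂ) (hf : ContDiff ℝ (⊤ : ℕ∞) f)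
    (hfc : HasCompactSupport f) (a b : ℝ) :
    ∃ G : ℝ × ℝ → ℂ, Integrable G ∧ (∫ v, G v) = f (a, b) ∧
      ∀ v, G v = ∫ x : ℝ × ℝ, f x *
        cexp (-(2 * Real.pi * I * (v.1 * (x.1 - a) + v.2 * (x.2 - b)))) := by
  have hmp := WithLp.volume_preserving_ofLp ℝ ℝ
  have hemb : MeasurableEmbedding (@WithLp.ofLp 2 (ℝ × ℝ)) :=
    (MeasurableEquiv.toLp 2 (ℝ × ℝ)).symm.measurableEmbedding
  have hcd : ContDiff ℝ (⊤ : ℕ∞) (fun x : WithLp 2 (ℝ × ℝ) => f (WithLp.ofLp x)) :=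
    hf.comp (WithLp.prodContinuousLinearEquiv 2 ℝ ℝ ℝ).contDiff
  have hcs : HasCompactSupport (fun x : WithLp 2 (ℝ × ℝ) => f (WithLp.ofLp x)) :=
    hfc.comp_homeomorph (WithLp.prodContinuousLinearEquiv 2 ℝ ℝ ℝ).toHomeomorph
  let g : SchwartzMap (WithLp 2 (ℝ × ℝ)) ℂ := hcs.toSchwartzMap hcd
  have hg : ∀ x, g x = f (WithLp.ofLp x) := fun x => rfl
  let p : WithLp 2 (ℝ × ℝ) := WithLp.toLp 2 (a, b)
  have hinv : 𝓕⁻ (𝓕 g) p = g p := by rw [FourierTransform.fourierInv_fourier_eq]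
  rw [SchwartzMap.fourierInv_coe, Real.fourierInv_eq'] at hinv
  refine ⟨fun v => cexp (↑(2 * Real.pi * inner ℝ (WithLp.toLp 2 v) p) * I) *
    (𝓕 g) (WithLp.toLp 2 v), ?_, ?_, ?_⟩
  · rw [← hmp.integrable_comp_emb hemb]
    refine (𝓕 g).integrable.bdd_mul (c := 1) ?_ ?_
    · apply Continuous.aestronglyMeasurable
      fun_prop
    · filter_upwards with x
      rw [Complex.norm_exp_ofReal_mul_I]
  · rw [← hmp.integral_comp hemb]
    exact hinv
  · intro v
    dsimp only
    rw [SchwartzMap.fourier_coe, Real.fourier_eq', ← hmp.integral_comp hemb,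
      ← integral_const_mul]
    congr 1
    ext x
    rw [hg, smul_eq_mul, ← mul_assoc, ← Complex.exp_add, mul_comm]
    congr 2
    simp [WithLp.prod_inner_apply, p]
    ring

lemma aux_half (x e : ℝ) (he : 0 < e) :
    (∫ s in Set.Ioi (0:ℝ), cexp (-(2 * Real.pi * (e + I * x)) * s)) * (2 * Real.pi * I)
      = 1 / (x - I * e) := by
  have hre : (-(2 * Real.pi * (e + I * x)) : ℂ).re < 0 := by
    simp; positivity
  rw [integral_exp_mul_complex_Ioi hre]
  have h1 : (x - I * e : ℂ) ≠ 0 := by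
    intro h
    have := congrArg Complex.im h
    simp at this; linarith
  have h2 : (e + I * x : ℂ) = I * (x - I * e) := by
    linear_combination (e : ℂ) * I_mul_I
  have h3 : (Real.pi : ℂ) ≠ 0 := by exact_mod_cast Real.pi_ne_zero
  rw [h2]
  have := I_ne_zero
  simp only [ofReal_zero, mul_zero, Complex.exp_zero]
  field_simp

lemma aux_swap (f : ℝ × ℝ → ℂ) (hf : Continuous f) (hfc : HasCompactSupport f)
    (a b m e : ℝ) (he : 0 < e) (G : ℝ × ℝ → ℂ)
    (hG : ∀ v, G v = ∫ x : ℝ × ℝ, f x *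
        cexp (-(2 * Real.pi * I * (v.1 * (x.1 - a) + v.2 * (x.2 - b))))) :
    (∫ x : ℝ × ℝ, f x * cexp (2 * Real.pi * I * m * (x.1 + x.2 - a - b)) *
      (1 / ((x.1 - a : ℝ) - I * e) * (1 / ((x.2 - b : ℝ) - I * e)))) =
    (2 * Real.pi * I) ^ 2 * ∫ s in Set.Ioi (0:ℝ) ×ˢ Set.Ioi (0:ℝ),
      (Real.exp (-(2 * Real.pi * e) * s.1) * Real.exp (-(2 * Real.pi * e) * s.2) : ℝ) *
        G (s.1 - m, s.2 - m) := by
  simp only [← aux_half _ _ he, hG]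
  have hE : Integrable (fun s : ℝ × ℝ =>
      ((Real.exp (-(2 * Real.pi * e) * s.1) * Real.exp (-(2 * Real.pi * e) * s.2) : ℝ) : ℂ))
      (volume.restrict (Set.Ioi (0:ℝ) ×ˢ Set.Ioi (0:ℝ))) := by
    have h := integrableOn_exp_mul_Ioi (a := -(2 * Real.pi * e))
      (by have := Real.pi_pos; simp; positivity) 0
    rw [Measure.volume_eq_prod, ← Measure.prod_restrict]
    exact (Integrable.mul_prod h h).ofReal
  have hfi : Integrable f := hf.integrable_of_hasCompactSupport hfc
  have hF : Integrable (Function.uncurry fun (x s : ℝ × ℝ) =>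
      cexp ((2 * Real.pi * (m * (x.1 + x.2 - a - b) - s.1 * (x.1 - a) - s.2 * (x.2 - b)) : ℝ) * I)
      * (f x *
      ((Real.exp (-(2 * Real.pi * e) * s.1) * Real.exp (-(2 * Real.pi * e) * s.2) : ℝ) : ℂ)))
      (volume.prod (volume.restrict (Set.Ioi (0:ℝ) ×ˢ Set.Ioi (0:ℝ)))) := by
    refine (hfi.mul_prod hE).bdd_mul (c := 1) ?_ ?_
    · apply Continuous.aestronglyMeasurable
      fun_prop
    · filter_upwards with x
      rw [Complex.norm_exp_ofReal_mul_I]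
  have key := integral_integral_swap hF
  rw [← integral_const_mul]
  calc _ = (2 * Real.pi * I) ^ 2 * ∫ x : ℝ × ℝ, ∫ s in Set.Ioi (0:ℝ) ×ˢ Set.Ioi (0:ℝ), 
      cexp ((2 * Real.pi * (m * (x.1 + x.2 - a - b) - s.1 * (x.1 - a) - s.2 * (x.2 - b)) : ℝ) * I)
      * (f x *
      ((Real.exp (-(2 * Real.pi * e) * s.1) * Real.exp (-(2 * Real.pi * e) * s.2) : ℝ) : ℂ)) := by
        rw [← integral_const_mul]
        congr 1
        ext x
        have := setIntegral_prod_mul (μ := volume) (ν := volume)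
          (fun s : ℝ => cexp (-(2 * Real.pi * (e + I * (x.1 - a : ℝ))) * s))
          (fun s : ℝ => cexp (-(2 * Real.pi * (e + I * (x.2 - b : ℝ))) * s))
          (Set.Ioi 0) (Set.Ioi 0)
        rw [mul_mul_mul_comm (∫ s in Set.Ioi (0:ℝ), _), ← this,
          mul_comm _ (2 * Real.pi * I * (2 * Real.pi * I)),
          mul_left_comm, ← sq, ← integral_const_mul, Measure.volume_eq_prod]
        congr 2
        ext s
        push_cast
        rw [← Complex.exp_add, mul_assoc (f x), ← Complex.exp_add, ← Complex.exp_add,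
          mul_left_comm, ← Complex.exp_add]
        congr 2
        ring
    _ = _ := by
        rw [key, ← integral_const_mul]
        congr 1
        ext s
        congr 1
        rw [← integral_const_mul]
        congr 1
        ext x
        push_cast
        rw [← Complex.exp_add, mul_left_comm, ← Complex.exp_add, mul_left_comm, ← Complex.exp_add]
        congr 2
        ring

lemma aux_main (f : ℝ × ℝ → ℂ) (hf : ContDiff ℝ (⊤ : ℕ∞) f)
    (hfc : HasCompactSupport f) (a b : ℝ) :
    ∃ L : ℝ → ℂ,
      (∀ lam : ℝ, 
        Tendsto (fun e : ℝ =>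
            ∫ x : ℝ × ℝ, f x * cexp (I * lam * (x.1 + x.2 - a - b)) *
              (1 / ((x.1 - a : ℝ) - I * e) * (1 / ((x.2 - b : ℝ) - I * e))))
          (nhdsWithin 0 (Set.Ioi 0)) (nhds (L lam))) ∧
      Tendsto L atTop (nhds ((2 * (Real.pi : ℂ) * I) ^ 2 * f (a, b))) := by
  obtain ⟨G, hGi, hGint, hG⟩ := aux_fourier f hf hfc a b
  have hpi : (Real.pi : ℂ) ≠ 0 := by exact_mod_cast Real.pi_ne_zero
  have hQ : MeasurableSet (Set.Ioi (0:ℝ) ×ˢ Set.Ioi (0:ℝ)) :=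
    measurableSet_Ioi.prod measurableSet_Ioi
  have hsh : ∀ m : ℝ, Integrable (fun s : ℝ × ℝ => G (s.1 - m, s.2 - m)) := fun m =>
    hGi.comp_sub_right (m, m)
  refine ⟨fun lam => (2 * (Real.pi : ℂ) * I) ^ 2 *
    ∫ s in Set.Ioi (0:ℝ) ×ˢ Set.Ioi (0:ℝ),
      G (s.1 - lam / (2 * Real.pi), s.2 - lam / (2 * Real.pi)), ?_, ?_⟩
  · intro lam
    set m : ℝ := lam / (2 * Real.pi) with hm
    have hlam : (lam : ℂ) = 2 * Real.pi * m := by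
      rw [hm]; push_cast; field_simp
    have hev : ∀ᶠ e in nhdsWithin (0:ℝ) (Set.Ioi 0), 
        (2 * Real.pi * I) ^ 2 * (∫ s in Set.Ioi (0:ℝ) ×ˢ Set.Ioi (0:ℝ),
      (Real.exp (-(2 * Real.pi * e) * s.1) * Real.exp (-(2 * Real.pi * e) * s.2) : ℝ) *
        G (s.1 - m, s.2 - m)) = ∫ x : ℝ × ℝ, f x * cexp (I * lam * (x.1 + x.2 - a - b)) *
              (1 / ((x.1 - a : ℝ) - I * e) * (1 / ((x.2 - b : ℝ) - I * e))) := by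
      filter_upwards [self_mem_nhdsWithin] with e he
      rw [← aux_swap f hf.continuous hfc a b m e he G hG]
      congr 1
      ext x
      congr 3
      rw [hlam]; ring
    refine Tendsto.congr' hev (Tendsto.const_mul _ ?_)
    refine tendsto_integral_filter_of_dominated_convergence
      (fun s => ‖G (s.1 - m, s.2 - m)‖) ?_ ?_ (hsh m).norm.restrict ?_
    · filter_upwards with e
      refine AEStronglyMeasurable.mul ?_ (hsh m).aestronglyMeasurable.restrict
      apply Continuous.aestronglyMeasurable
      fun_prop
    · filter_upwards [self_mem_nhdsWithin] with e he
      filter_upwards [ae_restrict_mem hQ] with s hs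
      have he' : 0 < e := he
      have h1 : 0 < s.1 := hs.1
      have h2 : 0 < s.2 := hs.2
      have hp := Real.pi_pos
      rw [norm_mul, ← Real.exp_add, Complex.norm_real, Real.norm_of_nonneg (Real.exp_pos _).le]
      refine mul_le_of_le_one_left (norm_nonneg _) (Real.exp_le_one_iff.2 ?_)
      have : 0 < 2 * Real.pi * e * (s.1 + s.2) := by positivity
      linarith
    · filter_upwards with s
      have hc : Continuous (fun e : ℝ => ((Real.exp (-(2 * Real.pi * e) * s.1) *
        Real.exp (-(2 * Real.pi * e) * s.2) : ℝ) : ℂ) * G (s.1 - m, s.2 - m)) := by fun_prop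
      have := hc.tendsto 0
      simp only [mul_zero, neg_zero, zero_mul, Real.exp_zero, mul_one, ofReal_one, one_mul] at this
      exact this.mono_left nhdsWithin_le_nhds
  · refine Tendsto.const_mul _ ?_
    rw [← hGint]
    have hrew : ∀ lam : ℝ, (∫ s in Set.Ioi (0:ℝ) ×ˢ Set.Ioi (0:ℝ),
      G (s.1 - lam / (2 * Real.pi), s.2 - lam / (2 * Real.pi))) =
      ∫ s, (Set.Ioi (-(lam / (2 * Real.pi))) ×ˢ Set.Ioi (-(lam / (2 * Real.pi)))).indicator G s := by
      intro lam
      set m : ℝ := lam / (2 * Real.pi)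
      rw [← integral_indicator hQ, ← integral_add_right_eq_self _ ((m, m) : ℝ × ℝ)]
      congr 1
      ext s
      simp only [Set.indicator, Set.mem_prod, Set.mem_Ioi, Prod.fst_add, Prod.snd_add,
        neg_lt_iff_pos_add, add_sub_cancel_right]
    simp only [hrew]
    refine tendsto_integral_filter_of_dominated_convergence (fun s => ‖G s‖) ?_ ?_ hGi.norm ?_
    · filter_upwards with lam
      exact hGi.aestronglyMeasurable.indicator (measurableSet_Ioi.prod measurableSet_Ioi)
    · filter_upwards with lam
      filter_upwards with s
      exact norm_indicator_le_norm_self _ _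
    · filter_upwards with s
      have ht : Tendsto (fun lam : ℝ => lam / (2 * Real.pi)) atTop atTop :=
        tendsto_id.atTop_div_const (by have := Real.pi_pos; positivity)
      refine tendsto_const_nhds.congr' ?_
      filter_upwards [ht.eventually_gt_atTop (-s.1), ht.eventually_gt_atTop (-s.2)] with lam h1 h2
      rw [Set.indicator_of_mem]
      exact ⟨by simp only [Set.mem_Ioi]; linarith, by simp only [Set.mem_Ioi]; linarith⟩

lemma aux_ne (x y e : ℝ) (he : 0 < e) : (x - y - I * e : ℂ) ≠ 0 := by
  intro h
  have := congrArg Complex.im h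
  simp at this; linarith

lemma aux_int (f : ℝ × ℝ → ℂ) (hf : Continuous f)
    (hfc : HasCompactSupport f) (a b lam e : ℝ) (he : 0 < e) :
    Integrable (fun x : ℝ × ℝ => f x * cexp (I * lam * (x.1 + x.2 - a - b)) *
              (1 / ((x.1 - a : ℝ) - I * e) * (1 / ((x.2 - b : ℝ) - I * e)))) := by
  refine Continuous.integrable_of_hasCompactSupport ?_ (hfc.mul_right.mul_right)
  have h1 : ∀ x : ℝ × ℝ, ((x.1 - a : ℝ) - I * e : ℂ) ≠ 0 := fun x => by
    push_cast; exact aux_ne _ _ _ he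
  have h2 : ∀ x : ℝ × ℝ, ((x.2 - b : ℝ) - I * e : ℂ) ≠ 0 := fun x => by
    push_cast; exact aux_ne _ _ _ he
  refine Continuous.mul (by fun_prop) (Continuous.mul ?_ ?_)
  · exact continuous_const.div (by fun_prop) h1
  · exact continuous_const.div (by fun_prop) h2

theorem delta_sequence_n_two (f : ℝ × ℝ → ℂ) (hf : ContDiff ℝ (⊤ : ℕ∞) f)
    (hfc : HasCompactSupport f) (y₁ y₂ : ℝ) :
    ∃ L : ℝ → ℂ,
      (∀ lam : ℝ, 0 < lam →
        Tendsto (fun eps : ℝ =>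
            ∫ x : ℝ × ℝ,
              f x * Complex.exp (Complex.I * (lam : ℂ) * ((x.1 + x.2 - y₁ - y₂ : ℝ) : ℂ))
                * ((x.1 - x.2 : ℝ) : ℂ) * ((y₂ - y₁ : ℝ) : ℂ)
                / ((((x.1 : ℝ) : ℂ) - (y₁ : ℂ) - Complex.I * (eps : ℂ))
                  * (((x.1 : ℝ) : ℂ) - (y₂ : ℂ) - Complex.I * (eps : ℂ))
                  * (((x.2 : ℝ) : ℂ) - (y₁ : ℂ) - Complex.I * (eps : ℂ))
                  * (((x.2 : ℝ) : ℂ) - (y₂ : ℂ) - Complex.I * (eps : ℂ))))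
          (nhdsWithin 0 (Set.Ioi 0)) (nhds (L lam))) ∧
      Tendsto L atTop
        (nhds ((2 * (Real.pi : ℂ) * Complex.I) ^ 2 * (f (y₁, y₂) - f (y₂, y₁)))) := by
  obtain ⟨L₁, h₁, h₁'⟩ := aux_main f hf hfc y₁ y₂
  obtain ⟨L₂, h₂, h₂'⟩ := aux_main f hf hfc y₂ y₁
  refine ⟨fun lam => L₁ lam - L₂ lam, ?_, ?_⟩
  · intro lam _
    refine ((h₁ lam).sub (h₂ lam)).congr' ?_
    filter_upwards [self_mem_nhdsWithin] with e he
    rw [← integral_sub (aux_int f hf.continuous hfc _ _ _ _ he)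
      (aux_int f hf.continuous hfc _ _ _ _ he)]
    congr 1
    ext x
    have a1 := aux_ne x.1 y₁ e he
    have a2 := aux_ne x.1 y₂ e he
    have a3 := aux_ne x.2 y₁ e he
    have a4 := aux_ne x.2 y₂ e he
    push_cast
    rw [show (x.1 + x.2 - y₂ - y₁ : ℂ) = x.1 + x.2 - y₁ - y₂ by ring]
    generalize cexp _ = E
    field_simp
    ring
  · rw [mul_sub]
    exact h₁'.sub h₂'
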